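/- Let V_h be a subspace of V, and let ψ_h, ψ_r ∈ V_h and u_h', u_r' ∈ V_h. Suppose ψ_h' ∈ V_h satisfies the adjoint sensitivity equation A(w, ψ_h') + B(w, ψ_h) = (y − O(u_h'))ᵀ Γ⁻¹ O(w) for all w ∈ V_h, and let ψ_r' ∈ V_h be arbitrary. Define the adjoint sensitivity residual dual norm ‖R_ψ'‖ = sup { |A(w, ψ_r') + B(w, ψ_r) − (y − O(u_r'))ᵀ Γ⁻¹ O(w)| : w ∈ V_h, ‖w‖_V ≤ 1 }. Then ‖ψ_h' − ψ_r'‖_V ≤ ‖R_ψ'‖ / α + (ρ/α) ‖ψ_h − ψ_r‖_V + (C_O/α) ‖u_h' − u_r'‖_V. -/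

import Mathlib

open scoped RealInnerProductSpace

/-- The continuous linear map on Euclidean space associated with a square matrix;
its operator norm is the spectral norm of the matrix. -/
noncomputable def matCLM {s : ℕ} (M : Matrix (Fin s) (Fin s) ℝ) :
    EuclideanSpace ℝ (Fin s) →L[ℝ] EuclideanSpace ℝ (Fin s) :=
  Matrix.toEuclideanCLM (𝕜 := ℝ) M

/-- A continuous functional is bounded on a subspace by its dual norm over the unit ball there. -/
theorem ContinuousLinearMap.abs_apply_le_sSup_mul_norm
    {V : Type*} [NormedAddCommGroup V] [NormedSpace ℝ V] (L : V →L[ℝ] ℝ)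
    {W : Submodule ℝ V} {w : V} (hw : w ∈ W) :
    |L w| ≤ sSup {r : ℝ | ∃ v ∈ W, ‖v‖ ≤ 1 ∧ r = |L v|} * ‖w‖ := by
  rcases eq_or_ne w 0 with rfl | hw0
  · simp
  have hn : 0 < ‖w‖ := norm_pos_iff.mpr hw0
  have hbdd : BddAbove {r : ℝ | ∃ v ∈ W, ‖v‖ ≤ 1 ∧ r = |L v|} := by
    refine ⟨‖L‖, ?_⟩
    rintro _ ⟨v, -, hv, rfl⟩
    exact L.unit_le_opNorm v hv
  have hle : |L (‖w‖⁻¹ • w)| ≤ sSup {r : ℝ | ∃ v ∈ W, ‖v‖ ≤ 1 ∧ r = |L v|} := by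
    refine le_csSup hbdd ⟨‖w‖⁻¹ • w, W.smul_mem _ hw, ?_, rfl⟩
    rw [norm_smul, norm_inv, norm_norm, inv_mul_cancel₀ hn.ne']
  rwa [map_smul, smul_eq_mul, abs_mul, abs_of_pos (inv_pos.mpr hn), inv_mul_le_iff₀ hn,
    mul_comm] at hle

/-- **A-posteriori error bound for the reduced adjoint sensitivity.**
Let `V_h ⊆ V` be a subspace, `ψ_h, ψ_r, u_h', u_r' ∈ V_h`, and suppose `ψ_h' ∈ V_h`
satisfies `A(w, ψ_h') + B(w, ψ_h) = (y − O(u_h'))ᵀ Γ⁻¹ O(w)` for all `w ∈ V_h`, with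
`ψ_r' ∈ V_h` arbitrary. With
`‖R_ψ'‖ = sup { |A(w, ψ_r') + B(w, ψ_r) − (y − O(u_r'))ᵀ Γ⁻¹ O(w)| : w ∈ V_h, ‖w‖ ≤ 1 }`,
one has `‖ψ_h' − ψ_r'‖ ≤ ‖R_ψ'‖/α + (ρ/α)‖ψ_h − ψ_r‖ + (C_O/α)‖u_h' − u_r'‖`
where `C_O = ‖Γ⁻¹‖₂‖O‖²`. -/
theorem adjoint_sensitivity_residual_bound
    {V : Type*} [NormedAddCommGroup V] [InnerProductSpace ℝ V] [CompleteSpace V]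
    {s : ℕ}
    (A B : V →L[ℝ] V →L[ℝ] ℝ)
    (α ρ : ℝ) (hα : 0 < α) (hρ : 0 < ρ)
    (hcoer : ∀ w : V, α * ‖w‖ ^ 2 ≤ A w w)
    (hB : ∀ w v : V, B w v ≤ ρ * ‖w‖ * ‖v‖)
    (O : V →L[ℝ] EuclideanSpace ℝ (Fin s)) (y : EuclideanSpace ℝ (Fin s))
    (Γinv : Matrix (Fin s) (Fin s) ℝ) (hΓsymm : Γinv.IsSymm) (hΓpd : Γinv.PosDef)
    (Vh : Submodule ℝ V) (ψh ψr uh' ur' ψh' ψr' : V)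
    (hψh : ψh ∈ Vh) (hψr : ψr ∈ Vh) (huh' : uh' ∈ Vh) (hur' : ur' ∈ Vh)
    (hψh' : ψh' ∈ Vh) (hψr' : ψr' ∈ Vh)
    (hsens : ∀ w ∈ Vh, A w ψh' + B w ψh = ⟪y - O uh', matCLM Γinv (O w)⟫)
    (Rnorm : ℝ)
    (hR : Rnorm = sSup {r : ℝ | ∃ w ∈ Vh, ‖w‖ ≤ 1 ∧
      r = |A w ψr' + B w ψr - ⟪y - O ur', matCLM Γinv (O w)⟫|}) :
    ‖ψh' - ψr'‖ ≤ Rnorm / α + ρ / α * ‖ψh - ψr‖ +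
      ‖matCLM Γinv‖ * ‖O‖ ^ 2 / α * ‖uh' - ur'‖ := by
  set e := ψh' - ψr'
  have heW : e ∈ Vh := Vh.sub_mem hψh' hψr'
  have hres : |A e ψr' + B e ψr - ⟪y - O ur', matCLM Γinv (O e)⟫| ≤ Rnorm * ‖e‖ := by
    rw [hR]
    exact (A.flip ψr' + B.flip ψr -
      (innerSL ℝ (y - O ur')).comp ((matCLM Γinv).comp O)).abs_apply_le_sSup_mul_norm heW
  have hBe : B e (ψr - ψh) ≤ ρ * ‖e‖ * ‖ψh - ψr‖ := by
    rw [norm_sub_rev ψh]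
    exact hB _ _
  have hOe : ⟪O (ur' - uh'), matCLM Γinv (O e)⟫ ≤
      ‖matCLM Γinv‖ * ‖O‖ ^ 2 * ‖uh' - ur'‖ * ‖e‖ := by
    calc ⟪O (ur' - uh'), matCLM Γinv (O e)⟫
        ≤ ‖O (ur' - uh')‖ * ‖matCLM Γinv (O e)‖ := real_inner_le_norm _ _
      _ ≤ (‖O‖ * ‖ur' - uh'‖) * (‖matCLM Γinv‖ * (‖O‖ * ‖e‖)) := by
          gcongr
          · exact O.le_opNorm _
          · exact (matCLM Γinv).le_opNorm_of_le (O.le_opNorm _)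
      _ = ‖matCLM Γinv‖ * ‖O‖ ^ 2 * ‖uh' - ur'‖ * ‖e‖ := by
          rw [norm_sub_rev ur']
          ring
  have herr : A e e = -(A e ψr' + B e ψr - ⟪y - O ur', matCLM Γinv (O e)⟫) +
      B e (ψr - ψh) + ⟪O (ur' - uh'), matCLM Γinv (O e)⟫ := by
    have hAe : A e e = A e ψh' - A e ψr' := (A e).map_sub ψh' ψr'
    have hs := hsens e heW
    rw [hAe, map_sub (B e), map_sub O ur' uh']
    simp only [inner_sub_left] at hs ⊢
    linarith
  have hRnorm : 0 ≤ Rnorm := by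
    rw [hR]
    refine Real.sSup_nonneg ?_
    rintro _ ⟨w, -, -, rfl⟩
    exact abs_nonneg _
  have hmain : α * ‖e‖ ^ 2 ≤
      (Rnorm + ρ * ‖ψh - ψr‖ + ‖matCLM Γinv‖ * ‖O‖ ^ 2 * ‖uh' - ur'‖) * ‖e‖ := by
    linarith [hcoer e, (neg_le_abs _).trans hres]
  have hbound : ‖e‖ ≤
      (Rnorm + ρ * ‖ψh - ψr‖ + ‖matCLM Γinv‖ * ‖O‖ ^ 2 * ‖uh' - ur'‖) / α := by
    rw [le_div_iff₀' hα]
    rcases (norm_nonneg e).eq_or_lt with h0 | hpos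
    · rw [← h0, mul_zero]
      positivity
    · refine le_of_mul_le_mul_right ?_ hpos
      linarith
  refine hbound.trans_eq ?_
  ring
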